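/- arXiv:math/0412085 — 2 statements merged into one kernel-verified Lean document; each statement's English description precedes it below -/
import Mathlib

section
/- Let T be a k-linear triangulated category with arbitrary coproducts which is compactly generated, and let X, X′ be objects of T with X compact. If there is an isomorphism of k-modules D Hom_T(X, Y) ≅ Hom_T(Y, X′), natural in Y, for all compact objects Y of T, then there is an isomorphism of k-modules D Hom_T(X, Y) ≅ Hom_T(Y, X′), natural in Y, for all objects Y of T. -/
open CategoryTheory CategoryTheory.Limits CategoryTheory.Pretriangulated

universe v u₁ u

/-- An object `X` of a preadditive category is *compact* if for every family of objects
`(Y i)` admitting a coproduct, the canonical map `⊕ᵢ Hom(X, Y i) → Hom(X, ∐ᵢ Y i)` is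
bijective. -/
def IsCompactObj {C : Type*} [Category.{v} C] [Preadditive C] (X : C) : Prop :=
  ∀ ⦃I : Type v⦄ (Y : I → C) (c : Cofan Y), IsColimit c →
    letI := Classical.decEq I
    Function.Bijective
      (DFinsupp.sumAddHom (β := fun i => X ⟶ Y i)
        (fun i => AddMonoidHom.mk' (fun g => g ≫ c.inj i)
          (fun _ _ => Preadditive.add_comp _ _ _ _ _ _)))

/-- A triangulated category with coproducts is *compactly generated* if the only strictly
full triangulated subcategory closed under arbitrary coproducts and containing all compact
objects is the whole category. -/
def IsCompGenTriangulated (T : Type u₁) [Category.{v} T] [HasZeroObject T] [Preadditive T]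
    [HasShift T ℤ] [∀ n : ℤ, (shiftFunctor T n).Additive] [Pretriangulated T] : Prop :=
  ∀ S : T → Prop,
    (∀ X Y : T, (X ≅ Y) → S X → S Y) →
    (∀ X : T, S X → S (X⟦(1 : ℤ)⟧)) →
    (∀ X : T, S X → S (X⟦(-1 : ℤ)⟧)) →
    (∀ Tr : Triangle T, (Tr ∈ distTriang T) →
      (S Tr.obj₁ → S Tr.obj₂ → S Tr.obj₃) ∧
      (S Tr.obj₁ → S Tr.obj₃ → S Tr.obj₂) ∧
      (S Tr.obj₂ → S Tr.obj₃ → S Tr.obj₁)) →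
    (∀ (I : Type v) (Y : I → T), (∀ i, S (Y i)) → ∀ c : Cofan Y, IsColimit c → S c.pt) →
    (∀ X : T, IsCompactObj X → S X) →
    ∀ X : T, S X

/-- The image of a colimit cofan under a functor preserving its colimit is a colimit cofan. -/
noncomputable def CategoryTheory.Limits.Cofan.isColimitMapObj {C : Type*} {D : Type*}
    [Category* C] [Category* D] (G : C ⥤ D) {I : Type*} {Y : I → C}
    [PreservesColimit (Discrete.functor Y) G] {c : Cofan Y} (hc : IsColimit c) :
    IsColimit (Cofan.mk (G.obj c.pt) fun i => G.map (c.inj i)) :=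
  isColimitCofanMkObjOfIsColimit G Y c.inj
    (hc.ofIsoColimit (Cocone.ext (Iso.refl _) (by rintro ⟨i⟩; simp [Cofan.inj])))

/-- A left adjoint whose right adjoint is additive and preserves coproducts preserves
compact objects. -/
theorem IsCompactObj.leftAdjoint_obj {C : Type*} {D : Type*} [Category.{v} C] [Category.{v} D]
    [Preadditive C] [Preadditive D] {F : C ⥤ D} {G : D ⥤ C} (adj : F ⊣ G) [G.Additive]
    [PreservesColimitsOfSize.{v, v} G] {X : C} (hX : IsCompactObj X) :
    IsCompactObj (F.obj X) := by
  intro I Y c hc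
  let _ := Classical.decEq I
  let hom (Z : D) : (F.obj X ⟶ Z) ≃+ (X ⟶ G.obj Z) :=
    { adj.homEquiv X Z with
      map_add' := fun f g => by simp [Adjunction.homEquiv_unit] }
  have key := hX (fun i => G.obj (Y i)) _ (Cofan.isColimitMapObj G hc)
  have comm : (hom c.pt).toAddMonoidHom.comp
      (DFinsupp.sumAddHom (β := fun i => F.obj X ⟶ Y i)
        (fun i => AddMonoidHom.mk' (fun g => g ≫ c.inj i)
          (fun _ _ => Preadditive.add_comp _ _ _ _ _ _))) =
      (DFinsupp.sumAddHom (β := fun i => X ⟶ G.obj (Y i))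
        (fun i => AddMonoidHom.mk' (fun g => g ≫ G.map (c.inj i))
          (fun _ _ => Preadditive.add_comp _ _ _ _ _ _))).comp
        (DFinsupp.mapRange.addEquiv (fun i => hom (Y i))).toAddMonoidHom := by
    refine DFinsupp.addHom_ext fun i g => ?_
    simp [hom, Adjunction.homEquiv_unit]
  have bij := key.comp (DFinsupp.mapRange.addEquiv (fun i => hom (Y i))).bijective
  rw [← Function.Bijective.of_comp_iff' (hom c.pt).bijective]
  exact (congrArg (fun Φ => Function.Bijective (DFunLike.coe Φ)) comm).mpr bij

/-- Shifts of compact objects are compact. -/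
theorem IsCompactObj.shift {C : Type*} [Category.{v} C] [Preadditive C] [HasShift C ℤ]
    [∀ n : ℤ, (shiftFunctor C n).Additive] {X : C} (hX : IsCompactObj X) (n : ℤ) :
    IsCompactObj (X⟦n⟧) :=
  have : (shiftEquiv C n).inverse.Additive := inferInstanceAs (shiftFunctor C (-n)).Additive
  hX.leftAdjoint_obj (shiftEquiv C n).toAdjunction

/-- Additive maps out of `Hom(X, ∐ᵢ Y i)` with `X` compact agree if they agree on morphisms that
factor through some summand `Y i`. -/
theorem IsCompactObj.addMonoidHom_ext {C : Type*} [Category.{v} C] [Preadditive C] {X : C}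
    (hX : IsCompactObj X) {I : Type v} {Y : I → C} {c : Cofan Y} (hc : IsColimit c)
    {A : Type*} [AddCommGroup A] {φ ψ : (X ⟶ c.pt) →+ A}
    (h : ∀ i (g : X ⟶ Y i), φ (g ≫ c.inj i) = ψ (g ≫ c.inj i)) : φ = ψ := by
  let _ := Classical.decEq I
  ext f
  obtain ⟨s, rfl⟩ := (hX Y c hc).2 f
  refine DFunLike.congr_fun (f := φ.comp _) (g := ψ.comp _)
    (DFinsupp.addHom_ext fun i g => ?_) s
  simpa using h i g

/-- A linear map into an injective module that vanishes on the kernel of `g` factors through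
`g`. -/
theorem Module.Injective.exists_comp_eq {k : Type u} [CommRing k] {E : Type u} [AddCommGroup E]
    [Module k E] [Module.Injective k E] {A B : Type*} [AddCommGroup A] [Module k A]
    [AddCommGroup B] [Module k B] (g : A →ₗ[k] B) (φ : A →ₗ[k] E)
    (h : ∀ a, g a = 0 → φ a = 0) : ∃ ψ : B →ₗ[k] E, ψ ∘ₗ g = φ := by
  obtain ⟨ψ, hψ⟩ := Module.Injective.extension_property k E _ _
    ((LinearMap.ker g).liftQ g le_rfl)
    (LinearMap.ker_eq_bot.1 (Submodule.ker_liftQ_eq_bot _ _ _ le_rfl))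
    ((LinearMap.ker g).liftQ φ h)
  refine ⟨ψ, LinearMap.ext fun a => ?_⟩
  exact LinearMap.congr_fun hψ (Submodule.Quotient.mk a)

section DualityPairing

variable {k : Type u} [CommRing k] {E : Type u} [AddCommGroup E] [Module k E]
  {T : Type u₁} [Category.{v} T] [Preadditive T] [Linear k T] {X X' : T}

/-- The natural map `Hom(Y, X') → D Hom(X, Y)` attached to a linear form
`t : Hom(X, X') → E`, sending `f` to `g ↦ t (g ≫ f)`. -/
def dualityPairing (t : (X ⟶ X') →ₗ[k] E) (Y : T) :
    (Y ⟶ X') →ₗ[k] ((X ⟶ Y) →ₗ[k] E) where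
  toFun f := t ∘ₗ Linear.rightComp k X f
  map_add' f g := by ext; simp
  map_smul' a f := by ext; simp

@[simp]
theorem dualityPairing_apply (t : (X ⟶ X') →ₗ[k] E) {Y : T} (f : Y ⟶ X') (g : X ⟶ Y) :
    dualityPairing t Y f g = t (g ≫ f) := rfl

theorem dualityPairing_comp (t : (X ⟶ X') →ₗ[k] E) {Y Y' : T} (g : Y ⟶ Y') (f : Y' ⟶ X') :
    dualityPairing t Y (g ≫ f) = dualityPairing t Y' f ∘ₗ Linear.rightComp k X g := by
  ext; simp

theorem dualityPairing_bijective_of_iso (t : (X ⟶ X') →ₗ[k] E) {Y Y' : T} (i : Y ≅ Y')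
    (h : Function.Bijective (dualityPairing t Y)) :
    Function.Bijective (dualityPairing t Y') := by
  refine ⟨(injective_iff_map_eq_zero _).2 fun f hf => ?_, fun φ => ?_⟩
  · have : i.hom ≫ f = 0 := h.1 (by rw [dualityPairing_comp, hf, map_zero, LinearMap.zero_comp])
    rw [← i.inv_hom_id_assoc f, this, comp_zero]
  · obtain ⟨f, hf⟩ := h.2 (φ ∘ₗ Linear.rightComp k X i.hom)
    refine ⟨i.inv ≫ f, ?_⟩
    rw [dualityPairing_comp, hf]
    ext; simp

theorem dualityPairing_bijective_of_isColimit (t : (X ⟶ X') →ₗ[k] E) (hX : IsCompactObj X)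
    {I : Type v} {Y : I → T} {c : Cofan Y} (hc : IsColimit c)
    (h : ∀ i, Function.Bijective (dualityPairing t (Y i))) :
    Function.Bijective (dualityPairing t c.pt) := by
  refine ⟨(injective_iff_map_eq_zero _).2 fun f hf => ?_, fun φ => ?_⟩
  · refine Cofan.IsColimit.hom_ext hc _ _ fun i => (h i).1 ?_
    rw [comp_zero, dualityPairing_comp, hf, map_zero, LinearMap.zero_comp]
  · choose f hf using fun i => (h i).2 (φ ∘ₗ Linear.rightComp k X (c.inj i))
    refine ⟨Cofan.IsColimit.desc hc f, LinearMap.toAddMonoidHom_injective <|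
      hX.addMonoidHom_ext hc fun i g => ?_⟩
    simpa using LinearMap.congr_fun (hf i) g

variable [HasZeroObject T] [HasShift T ℤ] [∀ n : ℤ, (shiftFunctor T n).Additive]
  [Pretriangulated T] [Module.Injective k E]

theorem dualityPairing_bijective_obj₃ (t : (X ⟶ X') →ₗ[k] E) (Tr : Triangle T)
    (hTr : Tr ∈ distTriang T)
    (h₁ : Function.Bijective (dualityPairing t Tr.obj₁))
    (h₂ : Function.Bijective (dualityPairing t Tr.obj₂))
    (h₁' : Function.Bijective (dualityPairing t (Tr.obj₁⟦(1 : ℤ)⟧)))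
    (h₂' : Function.Bijective (dualityPairing t (Tr.obj₂⟦(1 : ℤ)⟧))) :
    Function.Bijective (dualityPairing t Tr.obj₃) := by
  refine ⟨(injective_iff_map_eq_zero _).2 fun f hf => ?_, fun φ => ?_⟩
  · have hf₂ : Tr.mor₂ ≫ f = 0 :=
      h₂.1 (by rw [dualityPairing_comp, hf, map_zero, LinearMap.zero_comp])
    obtain ⟨f₁, rfl⟩ := Tr.yoneda_exact₃ hTr f hf₂
    obtain ⟨ψ, hψ⟩ := Module.Injective.exists_comp_eq
      (Linear.rightComp k X (Tr.mor₁⟦(1 : ℤ)⟧')) (dualityPairing t _ f₁) fun a ha => by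
        obtain ⟨b, rfl⟩ := Tr.coyoneda_exact₁ hTr a ha
        simpa using LinearMap.congr_fun hf b
    obtain ⟨f₂, rfl⟩ := h₂'.2 ψ
    rw [← dualityPairing_comp] at hψ
    rw [← h₁'.1 hψ, ← Category.assoc, comp_distTriang_mor_zero₃₁ _ hTr, zero_comp]
  · obtain ⟨f₂, hf₂⟩ := h₂.2 (φ ∘ₗ Linear.rightComp k X Tr.mor₂)
    have hf₁ : Tr.mor₁ ≫ f₂ = 0 := h₁.1 (by
      rw [dualityPairing_comp, hf₂, map_zero]
      ext
      simp [comp_distTriang_mor_zero₁₂ _ hTr])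
    obtain ⟨f₃, rfl⟩ := Tr.yoneda_exact₂ hTr f₂ hf₁
    obtain ⟨ψ, hψ⟩ := Module.Injective.exists_comp_eq
      (Linear.rightComp k X Tr.mor₃) (φ - dualityPairing t _ f₃) fun a ha => by
        obtain ⟨b, rfl⟩ := Tr.coyoneda_exact₃ hTr a ha
        simpa [sub_eq_zero] using (LinearMap.congr_fun hf₂ b).symm
    obtain ⟨f₁, rfl⟩ := h₁'.2 ψ
    exact ⟨f₃ + Tr.mor₃ ≫ f₁, by rw [map_add, dualityPairing_comp, hψ, add_sub_cancel]⟩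

/-- In a compactly generated triangulated category, the pairing of a linear form is perfect as
soon as it is perfect on compact objects. -/
theorem dualityPairing_bijective (t : (X ⟶ X') →ₗ[k] E) (hT : IsCompGenTriangulated T)
    (hX : IsCompactObj X)
    (h : ∀ Y : T, IsCompactObj Y → Function.Bijective (dualityPairing t Y)) (Y : T) :
    Function.Bijective (dualityPairing t Y) := by
  let S : T → Prop := fun Y => ∀ n : ℤ, Function.Bijective (dualityPairing t (Y⟦n⟧))
  have S_shift (Y : T) (m : ℤ) (hY : S Y) : S (Y⟦m⟧) := fun n =>
    dualityPairing_bijective_of_iso t (shiftAdd Y m n) (hY (m + n))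
  have S_iso (Y Y' : T) (i : Y ≅ Y') (hY : S Y) : S Y' := fun n =>
    dualityPairing_bijective_of_iso t ((shiftFunctor T n).mapIso i) (hY n)
  have S_unshift (Y : T) (hY : S (Y⟦(1 : ℤ)⟧)) : S Y :=
    S_iso _ _ (shiftShiftNeg Y (1 : ℤ)) (S_shift _ (-1) hY)
  have S_obj₃ (Tr : Triangle T) (hTr : Tr ∈ distTriang T) (h₁ : S Tr.obj₁)
      (h₂ : S Tr.obj₂) : S Tr.obj₃ := fun n =>
    dualityPairing_bijective_obj₃ t _ (Tr.shift_distinguished hTr n) (h₁ n) (h₂ n)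
      (S_shift _ n h₁ 1) (S_shift _ n h₂ 1)
  have S_all : ∀ Y, S Y := by
    refine hT S S_iso (fun Y => S_shift Y 1) (fun Y => S_shift Y (-1)) (fun Tr hTr => ?_)
      (fun I Z hZ c hc n => ?_) (fun Y hY n => h _ (hY.shift n))
    · have hTr' := rot_of_distTriang _ hTr
      exact ⟨S_obj₃ Tr hTr,
        fun h₁ h₃ => S_unshift _ (S_obj₃ _ (rot_of_distTriang _ hTr') h₃ (S_shift _ 1 h₁)),
        fun h₂ h₃ => S_unshift _ (S_obj₃ _ hTr' h₂ h₃)⟩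
    · exact dualityPairing_bijective_of_isColimit t hX
        (Cofan.isColimitMapObj (shiftFunctor T n) hc) fun i => hZ i n
  exact dualityPairing_bijective_of_iso t ((shiftFunctorZero T ℤ).app Y) (S_all Y 0)

end DualityPairing

/-- let `T` be a `k`-linear compactly generated triangulated category and let
`X, X'` be objects of `T` with `X` compact.  If there is an isomorphism of `k`-modules
`D Hom_T(X, Y) ≅ Hom_T(Y, X')`, natural in `Y`, for all compact `Y`, then there is such an
isomorphism, natural in `Y`, for all objects `Y` of `T`.  Here `D = Hom_k(-, E)` where `E`
is an injective envelope of `k/𝔪` over the complete local noetherian ring `k`. -/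
theorem stmt_5 (k : Type u) [CommRing k] [IsNoetherianRing k] [IsLocalRing k]
    [IsAdicComplete (IsLocalRing.maximalIdeal k) k]
    (E : Type u) [AddCommGroup E] [Module k E] [Module.Injective k E]
    (ι : (k ⧸ IsLocalRing.maximalIdeal k) →ₗ[k] E) (hι : Function.Injective ι)
    (hess : ∀ N : Submodule k E, N ⊓ LinearMap.range ι = ⊥ → N = ⊥)
    (T : Type u₁) [Category.{v} T] [HasZeroObject T] [Preadditive T] [Linear k T]
    [HasShift T ℤ] [∀ n : ℤ, (shiftFunctor T n).Additive] [Pretriangulated T]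
    (hT : IsCompGenTriangulated T)
    (X X' : T) (hX : IsCompactObj X)
    (e : ∀ Y : T, IsCompactObj Y → (((X ⟶ Y) →ₗ[k] E) ≃ₗ[k] (Y ⟶ X')))
    (he : ∀ (Y Y' : T) (hY : IsCompactObj Y) (hY' : IsCompactObj Y') (g : Y ⟶ Y')
      (φ : (X ⟶ Y') →ₗ[k] E),
      e Y hY (φ ∘ₗ Linear.rightComp k X g) = g ≫ e Y' hY' φ) :
    ∃ e' : ∀ Y : T, ((X ⟶ Y) →ₗ[k] E) ≃ₗ[k] (Y ⟶ X'),
      ∀ (Y Y' : T) (g : Y ⟶ Y') (φ : (X ⟶ Y') →ₗ[k] E),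
        e' Y (φ ∘ₗ Linear.rightComp k X g) = g ≫ e' Y' φ := by
  let t : (X ⟶ X') →ₗ[k] E := LinearMap.applyₗ (𝟙 X) ∘ₗ (e X hX).symm.toLinearMap
  have ht (Y : T) (hY : IsCompactObj Y) : dualityPairing t Y = (e Y hY).symm.toLinearMap := by
    ext f g
    have := he X Y hX hY g ((e Y hY).symm f)
    rw [LinearEquiv.apply_symm_apply, ← LinearEquiv.eq_symm_apply] at this
    simp [t, ← this]
  have bij := dualityPairing_bijective t hT hX fun Y hY => by
    rw [ht Y hY]; exact (e Y hY).symm.bijective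
  refine ⟨fun Y => (LinearEquiv.ofBijective _ (bij Y)).symm, fun Y Y' g φ => ?_⟩
  rw [LinearEquiv.symm_apply_eq, LinearEquiv.ofBijective_apply, dualityPairing_comp]
  congr 1
  exact ((LinearEquiv.ofBijective _ (bij Y')).apply_symm_apply φ).symm
end

section
/- Let 0 → X →α Y →β Z → 0 be a short exact sequence in an abelian category. Then the sequence is an almost split sequence if and only if β is right almost split and the endomorphism ring of X is a local ring. -/
open CategoryTheory CategoryTheory.Limits

universe v u

variable {C : Type u} [Category.{v} C]

/-- A map `α : X ⟶ Y` is *left almost split* if `α` is not a section and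
every map `X ⟶ Y'` which is not a section factors through `α`. -/
def IsLeftAlmostSplit {X Y : C} (α : X ⟶ Y) : Prop :=
  (¬ ∃ r : Y ⟶ X, α ≫ r = 𝟙 X) ∧
    ∀ ⦃Y' : C⦄ (f : X ⟶ Y'), (¬ ∃ r : Y' ⟶ X, f ≫ r = 𝟙 X) → ∃ g : Y ⟶ Y', α ≫ g = f

/-- A map `β : Y ⟶ Z` is *right almost split* if `β` is not a retraction and
every map `Y' ⟶ Z` which is not a retraction factors through `β`. -/
def IsRightAlmostSplit {Y Z : C} (β : Y ⟶ Z) : Prop :=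
  (¬ ∃ s : Z ⟶ Y, s ≫ β = 𝟙 Z) ∧
    ∀ ⦃Y' : C⦄ (f : Y' ⟶ Z), (¬ ∃ s : Z ⟶ Y', s ≫ f = 𝟙 Z) → ∃ g : Y' ⟶ Y, g ≫ β = f

/-- The source of a left almost split map in a preadditive category has a local
endomorphism ring. -/
theorem IsLeftAlmostSplit.isLocalRing_end [Preadditive C] {X Y : C} {α : X ⟶ Y}
    (hα : IsLeftAlmostSplit α) : IsLocalRing (End X) := by
  obtain ⟨hns, hfac⟩ := hα
  have section_or_section : ∀ a b : X ⟶ X, a + b = 𝟙 X →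
      (∃ r, a ≫ r = 𝟙 X) ∨ ∃ r, b ≫ r = 𝟙 X := by
    intro a b hab
    by_contra! h
    obtain ⟨g, hg⟩ := hfac a (by simpa using h.1)
    obtain ⟨k, hk⟩ := hfac b (by simpa using h.2)
    exact hns ⟨g + k, by rw [Preadditive.comp_add, hg, hk, hab]⟩
  have one_ne_zero : 𝟙 X ≠ 0 := fun h => hns ⟨0, by rw [comp_zero, h]⟩
  have isIso_of_section : ∀ f r : X ⟶ X, f ≫ r = 𝟙 X → IsIso f := by
    intro f r hfr
    rcases section_or_section (r ≫ f) (𝟙 X - r ≫ f) (by abel) with ⟨t, ht⟩ | ⟨t, ht⟩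
    · have hft : f ≫ t = f := by
        calc f ≫ t = (f ≫ r) ≫ f ≫ t := by rw [hfr, Category.id_comp]
          _ = f ≫ (r ≫ f) ≫ t := by simp only [Category.assoc]
          _ = f := by rw [ht, Category.comp_id]
      exact ⟨r, hfr, by rwa [Category.assoc, hft] at ht⟩
    · have hf : f = 0 := by
        calc f = f ≫ (𝟙 X - r ≫ f) ≫ t := by rw [ht, Category.comp_id]
          _ = (f - (f ≫ r) ≫ f) ≫ t := by
            simp only [Preadditive.sub_comp, Preadditive.comp_sub, Category.id_comp,
              Category.assoc]
          _ = 0 := by rw [hfr, Category.id_comp, sub_self, zero_comp]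
      exact (one_ne_zero (by rw [← hfr, hf, zero_comp])).elim
  have : Nontrivial (End X) := ⟨𝟙 X, 0, one_ne_zero⟩
  refine ⟨fun {a b} hab => ?_⟩
  rw [isUnit_iff_isIso, isUnit_iff_isIso]
  exact (section_or_section a b hab).imp
    (fun ⟨r, hr⟩ => isIso_of_section a r hr) (fun ⟨r, hr⟩ => isIso_of_section b r hr)

/-- The pushout of a short exact sequence along a map out of its first term is short exact. -/
theorem CategoryTheory.ShortComplex.ShortExact.pushout_inr [Abelian C] {S : ShortComplex C}
    (hS : S.ShortExact) {Y' : C} (f : S.X₁ ⟶ Y') :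
    (ShortComplex.mk (pushout.inr S.f f) (pushout.desc S.g 0 (by simp))
      (pushout.inr_desc _ _ _)).ShortExact := by
  have := hS.mono_f
  have := hS.epi_g
  have : Epi (pushout.desc S.g (0 : Y' ⟶ S.X₃) (by simp) : pushout S.f f ⟶ S.X₃) :=
    epi_of_epi_fac (pushout.inl_desc _ _ _)
  refine { exact := ShortComplex.exact_of_g_is_cokernel _
             (CokernelCofork.IsColimit.ofπ' _ _ fun k hk => ?_) }
  have hz : S.f ≫ pushout.inl S.f f ≫ k = 0 := by
    rw [pushout.condition_assoc, hk, comp_zero]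
  refine ⟨hS.exact.desc _ hz, ?_⟩
  apply pushout.hom_ext
  · rw [pushout.inl_desc_assoc, hS.exact.g_desc]
  · rw [pushout.inr_desc_assoc, zero_comp]
    exact hk.symm

/-- If the second map of a short exact sequence is right almost split and the first term has
a local endomorphism ring, then the first map is left almost split. -/
theorem isLeftAlmostSplit_of_isRightAlmostSplit [Abelian C] {S : ShortComplex C}
    (hS : S.ShortExact) (hg : IsRightAlmostSplit S.g) [IsLocalRing (End S.X₁)] :
    IsLeftAlmostSplit S.f := by
  obtain ⟨hnr, hfac⟩ := hg
  have := hS.mono_f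
  have := hS.epi_g
  have hns : ¬ ∃ r : S.X₂ ⟶ S.X₁, S.f ≫ r = 𝟙 S.X₁ := fun ⟨r, hr⟩ =>
    let σ := ShortComplex.Splitting.ofExactOfRetraction S hS.exact r hr hS.epi_g
    hnr ⟨σ.s, σ.s_g⟩
  refine ⟨hns, fun Y' f hf => ?_⟩
  have hP := hS.pushout_inr f
  by_cases hγ : ∃ s : S.X₃ ⟶ pushout S.f f, s ≫ pushout.desc S.g (0 : Y' ⟶ S.X₃) (by simp) = 𝟙 S.X₃
  · obtain ⟨s, hs⟩ := hγ
    let σ := ShortComplex.Splitting.ofExactOfSection _ hP.exact s hs hP.mono_f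
    have hr : pushout.inr S.f f ≫ σ.r = 𝟙 Y' := σ.f_r
    exact ⟨pushout.inl S.f f ≫ σ.r, by rw [pushout.condition_assoc, hr, Category.comp_id]⟩
  · exfalso
    obtain ⟨p, hp⟩ := hfac _ hγ
    have hp₁ : pushout.inl S.f f ≫ p ≫ S.g = S.g := by rw [hp, pushout.inl_desc]
    have hp₂ : (pushout.inr S.f f ≫ p) ≫ S.g = 0 := by
      rw [Category.assoc, hp, pushout.inr_desc]
    let h := hS.exact.lift _ hp₂
    have hh : h ≫ S.f = pushout.inr S.f f ≫ p := hS.exact.lift_f _ _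
    have hφ : (𝟙 S.X₂ - pushout.inl S.f f ≫ p) ≫ S.g = 0 := by
      rw [Preadditive.sub_comp, Category.id_comp, Category.assoc, hp₁, sub_self]
    let ψ := hS.exact.lift _ hφ
    have hψ : ψ ≫ S.f = 𝟙 S.X₂ - pushout.inl S.f f ≫ p := hS.exact.lift_f _ _
    have hsum : f ≫ h + S.f ≫ ψ = 𝟙 S.X₁ := by
      rw [← cancel_mono S.f, Preadditive.add_comp, Category.assoc, Category.assoc, hh, hψ,
        Preadditive.comp_sub, pushout.condition_assoc]
      simp
    rcases IsLocalRing.isUnit_or_isUnit_of_add_one (R := End S.X₁) hsum with hu | hu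
    · have := (isUnit_iff_isIso (f ≫ h)).1 hu
      exact hf ⟨h ≫ inv (f ≫ h), by rw [← Category.assoc, IsIso.hom_inv_id]⟩
    · have := (isUnit_iff_isIso (S.f ≫ ψ)).1 hu
      exact hns ⟨ψ ≫ inv (S.f ≫ ψ), by rw [← Category.assoc, IsIso.hom_inv_id]⟩

/-- a short exact sequence `0 → X → Y → Z → 0` in an abelian category is an
almost split sequence if and only if its second map is right almost split and the
endomorphism ring of `X` is local. -/
theorem stmt_12 {A : Type u} [Category.{v} A] [Abelian A]
    (S : ShortComplex A) (hS : S.ShortExact) :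
    (IsLeftAlmostSplit S.f ∧ IsRightAlmostSplit S.g) ↔
      (IsRightAlmostSplit S.g ∧ IsLocalRing (End S.X₁)) := by
  refine ⟨fun ⟨hf, hg⟩ => ⟨hg, hf.isLocalRing_end⟩, fun ⟨hg, hX⟩ => ⟨?_, hg⟩⟩
  exact isLeftAlmostSplit_of_isRightAlmostSplit hS hg
end
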